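/- Let A₅ be the alternating group on the five-element set {0,1,2,3,4}, acting on the group ℤ^{[0,4]} of functions from {0,1,2,3,4} to ℤ by permuting coordinates, and form the semidirect product W := ℤ^{[0,4]} ⋊ A₅. Let H be the normal closure in W of the canonical copy of A₅, i.e. H = ⟨ f g f⁻¹ : f ∈ ℤ^{[0,4]}, g ∈ A₅ ⟩. Then H is finitely generated and H is perfect, i.e. H = [H, H]. -/

import Mathlib

/-- The action of `Equiv.Perm (Fin 5)` on `ℤ^{[0,4]}` (written multiplicatively as
`Fin 5 → Multiplicative ℤ`) by permuting coordinates: `(σ • f) i = f (σ⁻¹ i)`. -/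
def permAction : Equiv.Perm (Fin 5) →* MulAut (Fin 5 → Multiplicative ℤ) where
  toFun σ := MulEquiv.arrowCongr σ (MulEquiv.refl (Multiplicative ℤ))
  map_one' := by
    ext f i
    rfl
  map_mul' σ τ := by
    ext f i
    rfl

/-- The action of `A₅ ≤ Sym({0,…,4})` on `ℤ^{[0,4]}` by permuting coordinates. -/
def a5Action : (alternatingGroup (Fin 5)) →* MulAut (Fin 5 → Multiplicative ℤ) :=
  permAction.comp (alternatingGroup (Fin 5)).subtype

/-- The wreath-like group `W = ℤ^{[0,4]} ⋊ A₅`. -/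
abbrev WGroup : Type :=
  (Fin 5 → Multiplicative ℤ) ⋊[a5Action] (alternatingGroup (Fin 5))

/-- A subgroup of a finitely generated commutative group is finitely generated. -/
theorem Subgroup.fg_of_commGroup_fg {A : Type*} [CommGroup A] [Group.FG A] (K : Subgroup A) :
    K.FG := by
  have : Module.Finite ℤ (Additive A) :=
    Module.Finite.iff_addGroup_fg.mpr inferInstance
  rw [Subgroup.fg_iff_add_fg, ← AddSubgroup.toIntSubmodule_toAddSubgroup K.toAddSubgroup,
    ← Submodule.fg_iff_addSubgroup_fg]
  exact IsNoetherian.noetherian _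

/-- The image of a finitely generated subgroup is finitely generated. -/
theorem Subgroup.FG.map_monoidHom {G G' : Type*} [Group G] [Group G'] {K : Subgroup G} (hK : K.FG)
    (f : G →* G') : (K.map f).FG := by
  rw [Subgroup.fg_iff_submonoid_fg] at hK ⊢
  exact hK.map f

namespace SemidirectProduct

variable {N G : Type*} [Group N] [Group G] {φ : G →* MulAut N}

/-- A subgroup containing the complement `G` is generated by `G` and its intersection with `N`. -/
theorem map_inl_comap_inl_sup_range_inr {H : Subgroup (N ⋊[φ] G)}
    (hH : (inr : G →* N ⋊[φ] G).range ≤ H) :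
    (H.comap inl).map inl ⊔ (inr : G →* N ⋊[φ] G).range = H := by
  refine le_antisymm (sup_le (Subgroup.map_comap_le _ _) hH) fun x hx ↦ ?_
  rw [← inl_left_mul_inr_right x] at hx ⊢
  have hr : inr x.right ∈ (inr : G →* N ⋊[φ] G).range := ⟨_, rfl⟩
  exact Subgroup.mul_mem_sup
    (Subgroup.mem_map_of_mem _ ((Subgroup.mul_mem_cancel_right H (hH hr)).mp hx)) hr

end SemidirectProduct

/-- The normal closure of the image of a perfect group is perfect. -/
theorem Subgroup.commutator_normalClosure_range_of_perfect {G W : Type*} [Group G] [Group W]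
    (hG : _root_.commutator G = ⊤) (f : G →* W) :
    ⁅normalClosure (Set.range f), normalClosure (Set.range f)⁆ = normalClosure (Set.range f) := by
  refine le_antisymm (Subgroup.commutator_le_left _ _) (normalClosure_le_normal ?_)
  have h : (⊤ : Subgroup G).map f ≤ normalClosure (Set.range f) := by
    rw [← MonoidHom.range_eq_map]
    exact subset_normalClosure
  suffices (⊤ : Subgroup G).map f ≤ ⁅normalClosure (Set.range f), normalClosure (Set.range f)⁆ by
    rwa [← MonoidHom.coe_range, SetLike.coe_subset_coe, MonoidHom.coe_range,
      MonoidHom.range_eq_map]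
  calc (⊤ : Subgroup G).map f = ⁅(⊤ : Subgroup G).map f, (⊤ : Subgroup G).map f⁆ := by
        rw [← map_commutator, ← _root_.commutator_def, hG]
    _ ≤ _ := commutator_mono h h

/-- The normal closure `H` in `W = ℤ^{[0,4]} ⋊ A₅` of the canonical copy of `A₅` is a
finitely generated perfect group: `H = [H, H]`. -/
theorem normalClosure_inr_fg_and_perfect :
    (Subgroup.normalClosure
        (Set.range (SemidirectProduct.inr : (alternatingGroup (Fin 5)) →* WGroup))).FG ∧
      ⁅Subgroup.normalClosure
          (Set.range (SemidirectProduct.inr : (alternatingGroup (Fin 5)) →* WGroup)),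
        Subgroup.normalClosure
          (Set.range (SemidirectProduct.inr : (alternatingGroup (Fin 5)) →* WGroup))⁆ =
        Subgroup.normalClosure
          (Set.range (SemidirectProduct.inr : (alternatingGroup (Fin 5)) →* WGroup)) := by
  refine ⟨?_, Subgroup.commutator_normalClosure_range_of_perfect
    (commutator_alternatingGroup_eq_top (by simp)) _⟩
  have h : (SemidirectProduct.inr : (alternatingGroup (Fin 5)) →* WGroup).range ≤
      Subgroup.normalClosure (Set.range SemidirectProduct.inr) := Subgroup.subset_normalClosure
  rw [← SemidirectProduct.map_inl_comap_inl_sup_range_inr h]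
  exact ((Subgroup.fg_of_commGroup_fg _).map_monoidHom _).sup
    ((Group.fg_iff_subgroup_fg _).mp inferInstance)
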